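/- Let u, v : ℝ × ℝ → ℝ be smooth functions of (x,t) solving the generalized Riemann equation at N=2, i.e. u_t = 2u·u_x − 2v and v_t = 2u·v_x, with v_x nowhere zero. Fix n ≥ 2, let Q : ℝ^{2(n−1)} → ℝ be a smooth function of the variables (a₁, b₁, …, a_{n−1}, b_{n−1}), and let P : ℝ^{2n} → ℝ be a smooth function of (a₁, b₁, …, a_n, b_n) whose partial derivative with respect to b₁ satisfies ∂P/∂b₁ = −(1/2)·Σ_{k=1}^{n−1}[(∂Q/∂a_k)·a_{k+1} + (∂Q/∂b_k)·b_{k+1}] identically on ℝ^{2n}. Then the function H = v_x·P(α₁, β₁, …, α_n, β_n) satisfies the conservation law ∂_t H = ∂_x(2u·H + Q(α₁, β₁, …, α_{n−1}, β_{n−1})) at every point. -/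

import Mathlib

/-- Partial derivative with respect to the first variable `x`. -/
noncomputable def pdx (f : ℝ × ℝ → ℝ) (p : ℝ × ℝ) : ℝ := deriv (fun x => f (x, p.2)) p.1

/-- Partial derivative with respect to the second variable `t`. -/
noncomputable def pdt (f : ℝ × ℝ → ℝ) (p : ℝ × ℝ) : ℝ := deriv (fun t => f (p.1, t)) p.2

/-- Partial derivative of a function on `ℝ^m` with respect to the `i`-th coordinate. -/
noncomputable def pD {m : ℕ} (f : (Fin m → ℝ) → ℝ) (i : Fin m) (y : Fin m → ℝ) : ℝ :=
  deriv (fun s => f (Function.update y i s)) (y i)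

lemma pdx_eq_fderiv {f : ℝ × ℝ → ℝ} (hf : Differentiable ℝ f) (p : ℝ × ℝ) :
    pdx f p = fderiv ℝ f p (1, 0) := by
  have h1 : HasDerivAt (fun x : ℝ => (x, p.2)) ((1 : ℝ), (0 : ℝ)) p.1 :=
    (hasDerivAt_id p.1).prodMk (hasDerivAt_const p.1 p.2)
  exact ((hf p).hasFDerivAt.comp_hasDerivAt (f := fun x : ℝ => (x, p.2)) p.1 h1).deriv

lemma pdt_eq_fderiv {f : ℝ × ℝ → ℝ} (hf : Differentiable ℝ f) (p : ℝ × ℝ) :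
    pdt f p = fderiv ℝ f p (0, 1) := by
  have h1 : HasDerivAt (fun t : ℝ => (p.1, t)) ((0 : ℝ), (1 : ℝ)) p.2 :=
    (hasDerivAt_const p.2 p.1).prodMk (hasDerivAt_id p.2)
  exact ((hf p).hasFDerivAt.comp_hasDerivAt (f := fun t : ℝ => (p.1, t)) p.2 h1).deriv

lemma pD_eq_fderiv {m : ℕ} {f : (Fin m → ℝ) → ℝ} (hf : Differentiable ℝ f) (i : Fin m)
    (y : Fin m → ℝ) : pD f i y = fderiv ℝ f y (Pi.single i 1) := by
  have h1 : HasDerivAt (Function.update y i) (Pi.single i (1 : ℝ)) (y i) :=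
    hasDerivAt_update y i (y i)
  have h2 : HasFDerivAt f (fderiv ℝ f y) (Function.update y i (y i)) := by
    rw [Function.update_eq_self]
    exact (hf y).hasFDerivAt
  exact (h2.comp_hasDerivAt (y i) h1).deriv

lemma contDiff_pdx {f : ℝ × ℝ → ℝ} (hf : ContDiff ℝ (⊤ : ℕ∞) f) :
    ContDiff ℝ (⊤ : ℕ∞) (pdx f) := by
  rw [funext (pdx_eq_fderiv (hf.differentiable (by simp)))]
  exact (hf.fderiv_right (m := (⊤ : ℕ∞)) (by simp)).clm_apply contDiff_const

lemma pdt_pdx {f : ℝ × ℝ → ℝ} (hf : ContDiff ℝ (⊤ : ℕ∞) f) (p : ℝ × ℝ) :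
    pdt (pdx f) p = pdx (pdt f) p := by
  have hd : Differentiable ℝ f := hf.differentiable (by simp)
  have hd2 : Differentiable ℝ (fderiv ℝ f) :=
    (hf.fderiv_right (m := (⊤ : ℕ∞)) (by simp)).differentiable (by simp)
  have key (w z : ℝ × ℝ) :
      fderiv ℝ (fun q => fderiv ℝ f q w) p z = fderiv ℝ (fderiv ℝ f) p z w := by
    rw [fderiv_clm_apply (hd2 p) (differentiableAt_const w)]
    simp
  have hsymm : IsSymmSndFDerivAt ℝ f p :=
    (hf.contDiffAt (x := p)).isSymmSndFDerivAt (by simpa using WithTop.coe_le_coe.2 (le_top : (2 : ℕ∞) ≤ ⊤))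
  rw [funext (pdx_eq_fderiv hd), funext (pdt_eq_fderiv hd),
    pdt_eq_fderiv (hd2.clm_apply (differentiable_const _)),
    pdx_eq_fderiv (hd2.clm_apply (differentiable_const _)), key, key]
  exact hsymm _ _

lemma pdx_mul {f g : ℝ × ℝ → ℝ} (hf : Differentiable ℝ f) (hg : Differentiable ℝ g)
    (p : ℝ × ℝ) : pdx (fun q => f q * g q) p = pdx f p * g p + f p * pdx g p := by
  rw [pdx_eq_fderiv (hf.fun_mul hg), pdx_eq_fderiv hf, pdx_eq_fderiv hg,
    fderiv_fun_mul (hf p) (hg p)]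
  simp
  ring

lemma pdt_mul {f g : ℝ × ℝ → ℝ} (hf : Differentiable ℝ f) (hg : Differentiable ℝ g)
    (p : ℝ × ℝ) : pdt (fun q => f q * g q) p = pdt f p * g p + f p * pdt g p := by
  rw [pdt_eq_fderiv (hf.fun_mul hg), pdt_eq_fderiv hf, pdt_eq_fderiv hg,
    fderiv_fun_mul (hf p) (hg p)]
  simp
  ring

lemma pdx_add {f g : ℝ × ℝ → ℝ} (hf : Differentiable ℝ f) (hg : Differentiable ℝ g)
    (p : ℝ × ℝ) : pdx (fun q => f q + g q) p = pdx f p + pdx g p := by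
  rw [pdx_eq_fderiv (hf.fun_add hg), pdx_eq_fderiv hf, pdx_eq_fderiv hg, fderiv_fun_add (hf p) (hg p)]
  simp

lemma pdt_add {f g : ℝ × ℝ → ℝ} (hf : Differentiable ℝ f) (hg : Differentiable ℝ g)
    (p : ℝ × ℝ) : pdt (fun q => f q + g q) p = pdt f p + pdt g p := by
  rw [pdt_eq_fderiv (hf.fun_add hg), pdt_eq_fderiv hf, pdt_eq_fderiv hg, fderiv_fun_add (hf p) (hg p)]
  simp

lemma pdx_const (c : ℝ) (p : ℝ × ℝ) : pdx (fun _ => c) p = 0 := by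
  simp [pdx]

lemma pdt_const (c : ℝ) (p : ℝ × ℝ) : pdt (fun _ => c) p = 0 := by
  simp [pdt]

lemma fderiv_comp_pi_eq_sum {m : ℕ} {f : (Fin m → ℝ) → ℝ} (hf : Differentiable ℝ f)
    {F : Fin m → ℝ × ℝ → ℝ} (hF : ∀ i, Differentiable ℝ (F i)) (p w : ℝ × ℝ) :
    fderiv ℝ (fun q => f (fun i => F i q)) p w
      = ∑ i, pD f i (fun i => F i p) * fderiv ℝ (F i) p w := by
  have h1 : HasFDerivAt (fun q i => F i q)
      (ContinuousLinearMap.pi fun i => fderiv ℝ (F i) p) p :=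
    hasFDerivAt_pi.2 fun i => (hF i p).hasFDerivAt
  have h2 := ((hf fun i => F i p).hasFDerivAt).comp (f := fun q i => F i q) p h1
  rw [show (fun q => f (fun i => F i q)) = f ∘ (fun q i => F i q) from rfl, h2.fderiv]
  simp only [ContinuousLinearMap.comp_apply, pD_eq_fderiv hf]
  rw [pi_eq_sum_univ' (ContinuousLinearMap.pi (fun i => fderiv ℝ (F i) p) w), map_sum]
  refine Finset.sum_congr rfl fun i _ => ?_
  rw [map_smul, smul_eq_mul, mul_comm]
  congr 2 with j

lemma pdx_comp_pi {m : ℕ} {f : (Fin m → ℝ) → ℝ} (hf : Differentiable ℝ f)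
    {F : Fin m → ℝ × ℝ → ℝ} (hF : ∀ i, Differentiable ℝ (F i)) (p : ℝ × ℝ) :
    pdx (fun q => f (fun i => F i q)) p = ∑ i, pD f i (fun i => F i p) * pdx (F i) p := by
  rw [pdx_eq_fderiv (f := fun q => f (fun i => F i q)) (hf.comp (differentiable_pi.2 hF)), fderiv_comp_pi_eq_sum hf hF]
  exact Finset.sum_congr rfl fun i _ => by rw [pdx_eq_fderiv (hF i)]

lemma pdt_comp_pi {m : ℕ} {f : (Fin m → ℝ) → ℝ} (hf : Differentiable ℝ f)
    {F : Fin m → ℝ × ℝ → ℝ} (hF : ∀ i, Differentiable ℝ (F i)) (p : ℝ × ℝ) :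
    pdt (fun q => f (fun i => F i q)) p = ∑ i, pD f i (fun i => F i p) * pdt (F i) p := by
  rw [pdt_eq_fderiv (f := fun q => f (fun i => F i q)) (hf.comp (differentiable_pi.2 hF)), fderiv_comp_pi_eq_sum hf hF]
  exact Finset.sum_congr rfl fun i _ => by rw [pdt_eq_fderiv (hF i)]

lemma sum_fin_two_mul : ∀ (m : ℕ) (f : Fin (2 * m) → ℝ),
    ∑ i, f i = ∑ k : Fin m, (f ⟨2 * k.val, by omega⟩ + f ⟨2 * k.val + 1, by omega⟩)
  | 0, f => by simp
  | m + 1, f => by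
    have h := sum_fin_two_mul m fun i => f (i.castLE (by omega))
    rw [Fin.sum_univ_castSucc (n := m)]
    refine (Fin.sum_univ_castSucc (n := 2 * m + 1) f).trans ?_
    rw [Fin.sum_univ_castSucc (n := 2 * m), add_assoc]
    exact congrArg₂ (· + ·) h rfl

section Transport

variable {u v : ℝ × ℝ → ℝ}

lemma pdt_pdx_of_transport {f : ℝ × ℝ → ℝ} (hu : ContDiff ℝ (⊤ : ℕ∞) u)
    (hf : ContDiff ℝ (⊤ : ℕ∞) f) {c : ℝ} (h : ∀ p, pdt f p = 2 * u p * pdx f p + c)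
    (p : ℝ × ℝ) :
    pdt (pdx f) p = 2 * pdx u p * pdx f p + 2 * u p * pdx (pdx f) p := by
  have hu' : Differentiable ℝ u := hu.differentiable (by simp)
  have hf' : Differentiable ℝ (pdx f) := (contDiff_pdx hf).differentiable (by simp)
  rw [pdt_pdx hf, funext h,
    pdx_add (((differentiable_const 2).fun_mul hu').fun_mul hf') (differentiable_const c),
    pdx_mul ((differentiable_const 2).fun_mul hu') hf', pdx_mul (differentiable_const 2) hu',
    pdx_const, pdx_const]
  ring

lemma transport_of_mul_eq_pdx {f g : ℝ × ℝ → ℝ} (hu : ContDiff ℝ (⊤ : ℕ∞) u)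
    (hv : ContDiff ℝ (⊤ : ℕ∞) v) (heqv : ∀ p, pdt v p = 2 * u p * pdx v p)
    (hvx : ∀ p, pdx v p ≠ 0)
    (hf : ContDiff ℝ (⊤ : ℕ∞) f) (hg : ContDiff ℝ (⊤ : ℕ∞) g) {c : ℝ}
    (h : ∀ p, pdt f p = 2 * u p * pdx f p + c) (hfg : ∀ p, pdx f p = pdx v p * g p)
    (p : ℝ × ℝ) : pdt g p = 2 * u p * pdx g p := by
  have hv' : Differentiable ℝ (pdx v) := (contDiff_pdx hv).differentiable (by simp)
  have hg' : Differentiable ℝ g := hg.differentiable (by simp)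
  have h1 := pdt_pdx_of_transport hu hf h p
  have h2 := pdt_pdx_of_transport hu hv (c := 0) (by simpa using heqv) p
  rw [funext hfg, pdt_mul hv' hg', pdx_mul hv' hg', h2] at h1
  apply mul_left_cancel₀ (hvx p)
  linear_combination h1

end Transport

theorem riemannN2_conservation_law_with_flux (u v : ℝ × ℝ → ℝ)
    (hu : ContDiff ℝ (⊤ : ℕ∞) u) (hv : ContDiff ℝ (⊤ : ℕ∞) v)
    (hequ : ∀ p : ℝ × ℝ, pdt u p = 2 * u p * pdx u p - 2 * v p)
    (heqv : ∀ p : ℝ × ℝ, pdt v p = 2 * u p * pdx v p)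
    (hvx : ∀ p : ℝ × ℝ, pdx v p ≠ 0)
    (n : ℕ) (hn : 2 ≤ n)
    (Q : (Fin (2 * (n - 1)) → ℝ) → ℝ) (hQ : ContDiff ℝ (⊤ : ℕ∞) Q)
    (P : (Fin (2 * n) → ℝ) → ℝ) (hP : ContDiff ℝ (⊤ : ℕ∞) P)
    (hPQ : ∀ y : Fin (2 * n) → ℝ,
      pD P ⟨1, by omega⟩ y
        = -(1 / 2) * ∑ k : Fin (n - 1),
            (pD Q ⟨2 * k.val, by have := k.isLt; omega⟩ (fun j => y (Fin.castLE (by omega) j))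
                * y ⟨2 * k.val + 2, by have := k.isLt; omega⟩
              + pD Q ⟨2 * k.val + 1, by have := k.isLt; omega⟩ (fun j => y (Fin.castLE (by omega) j))
                * y ⟨2 * k.val + 3, by have := k.isLt; omega⟩))
    (α β : ℕ → ℝ × ℝ → ℝ)
    (hα1 : ∀ p : ℝ × ℝ, α 1 p = (pdx u p) ^ 2 * ((pdx v p) ^ 2)⁻¹ - 2 * (pdx v p)⁻¹)
    (hβ1 : ∀ p : ℝ × ℝ, β 1 p = pdx u p * (pdx v p)⁻¹)
    (hαrec : ∀ k, 1 ≤ k → ∀ p : ℝ × ℝ, α (k + 1) p = (pdx v p)⁻¹ * pdx (α k) p)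
    (hβrec : ∀ k, 1 ≤ k → ∀ p : ℝ × ℝ, β (k + 1) p = (pdx v p)⁻¹ * pdx (β k) p) :
    ∀ p : ℝ × ℝ,
      pdt (fun q => pdx v q * P (fun i => if i.val % 2 = 0 then α (i.val / 2 + 1) q else β (i.val / 2 + 1) q)) p
        = pdx (fun q => 2 * u q * (pdx v q * P (fun i => if i.val % 2 = 0 then α (i.val / 2 + 1) q else β (i.val / 2 + 1) q))
            + Q (fun j => if j.val % 2 = 0 then α (j.val / 2 + 1) q else β (j.val / 2 + 1) q)) p := by
  have hud : Differentiable ℝ u := hu.differentiable (by simp)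
  have hvd : Differentiable ℝ v := hv.differentiable (by simp)
  have hux : ContDiff ℝ (⊤ : ℕ∞) (pdx u) := contDiff_pdx hu
  have hvxs : ContDiff ℝ (⊤ : ℕ∞) (pdx v) := contDiff_pdx hv
  have huxd : Differentiable ℝ (pdx u) := hux.differentiable (by simp)
  have hvxd : Differentiable ℝ (pdx v) := hvxs.differentiable (by simp)
  have hrec_smooth (a : ℕ → ℝ × ℝ → ℝ) (h1 : ContDiff ℝ (⊤ : ℕ∞) (a 1))
      (hrec : ∀ k, 1 ≤ k → ∀ p, a (k + 1) p = (pdx v p)⁻¹ * pdx (a k) p) (k : ℕ) :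
      ContDiff ℝ (⊤ : ℕ∞) (a (k + 1)) := by
    induction k with
    | zero => exact h1
    | succ k ih =>
      rw [funext (hrec (k + 1) (by omega))]
      exact (hvxs.inv hvx).mul (contDiff_pdx ih)
  have hα_smooth : ∀ k, ContDiff ℝ (⊤ : ℕ∞) (α (k + 1)) := by
    refine hrec_smooth α ?_ hαrec
    rw [funext hα1]
    exact ((hux.pow 2).mul ((hvxs.pow 2).inv fun p => pow_ne_zero 2 (hvx p))).sub
      (contDiff_const.mul (hvxs.inv hvx))
  have hβ_smooth : ∀ k, ContDiff ℝ (⊤ : ℕ∞) (β (k + 1)) := by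
    refine hrec_smooth β ?_ hβrec
    rw [funext hβ1]
    exact hux.mul (hvxs.inv hvx)
  have hrec_mul (a : ℕ → ℝ × ℝ → ℝ)
      (hrec : ∀ k, 1 ≤ k → ∀ p, a (k + 1) p = (pdx v p)⁻¹ * pdx (a k) p) (k : ℕ) (p : ℝ × ℝ) :
      pdx (a (k + 1)) p = pdx v p * a (k + 2) p := by
    rw [hrec (k + 1) (by omega), mul_inv_cancel_left₀ (hvx p)]
  have hvxt (p : ℝ × ℝ) : pdt (pdx v) p = 2 * pdx u p * pdx v p + 2 * u p * pdx (pdx v) p :=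
    pdt_pdx_of_transport hu hv (c := 0) (by simpa using heqv) p
  have huxt (p : ℝ × ℝ) :
      pdt (pdx u) p = 2 * pdx u p * pdx u p + 2 * u p * pdx (pdx u) p - 2 * pdx v p := by
    have h (p : ℝ × ℝ) : pdt u p = 2 * u p * pdx u p + -2 * v p := by rw [hequ]; ring
    rw [pdt_pdx hu, funext h,
      pdx_add (((differentiable_const 2).fun_mul hud).fun_mul huxd)
        ((differentiable_const (-2)).fun_mul hvd),
      pdx_mul ((differentiable_const 2).fun_mul hud) huxd, pdx_mul (differentiable_const 2) hud,
      pdx_mul (differentiable_const (-2)) hvd, pdx_const, pdx_const]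
    ring
  have hβ1d : Differentiable ℝ (β 1) := (hβ_smooth 0).differentiable (by simp)
  have hα1d : Differentiable ℝ (α 1) := (hα_smooth 0).differentiable (by simp)
  have hβ1t (p : ℝ × ℝ) : pdt (β 1) p = 2 * u p * pdx (β 1) p + -2 := by
    have h (p : ℝ × ℝ) : pdx u p = pdx v p * β 1 p := by
      rw [hβ1, mul_comm, inv_mul_cancel_right₀ (hvx p)]
    have h1 := pdt_mul hvxd hβ1d p
    have h2 := pdx_mul hvxd hβ1d p
    rw [← funext h] at h1 h2
    apply mul_left_cancel₀ (hvx p)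
    linear_combination huxt p - h1 + 2 * u p * h2 - β 1 p * hvxt p + 2 * pdx u p * h p
  have hα1t (p : ℝ × ℝ) : pdt (α 1) p = 2 * u p * pdx (α 1) p + 0 := by
    have h (p : ℝ × ℝ) : pdx v p * α 1 p = pdx u p * β 1 p + -2 := by
      rw [hα1, hβ1]
      field_simp [hvx p]
      ring
    have hb : pdx u p = pdx v p * β 1 p := by
      rw [hβ1, mul_comm, inv_mul_cancel_right₀ (hvx p)]
    have h1 := pdt_mul hvxd hα1d p
    have h2 := pdx_mul hvxd hα1d p
    rw [funext h, pdt_add (huxd.fun_mul hβ1d) (differentiable_const _), pdt_mul huxd hβ1d,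
      pdt_const] at h1
    rw [funext h, pdx_add (huxd.fun_mul hβ1d) (differentiable_const _), pdx_mul huxd hβ1d,
      pdx_const] at h2
    apply mul_left_cancel₀ (hvx p)
    linear_combination -h1 + 2 * u p * h2 - α 1 p * hvxt p + β 1 p * huxt p
      + pdx u p * hβ1t p - 2 * pdx u p * h p + 2 * hb
  have htransport (a : ℕ → ℝ × ℝ → ℝ) (hs : ∀ k, ContDiff ℝ (⊤ : ℕ∞) (a (k + 1)))
      (hrec : ∀ k, 1 ≤ k → ∀ p, a (k + 1) p = (pdx v p)⁻¹ * pdx (a k) p) (c : ℝ)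
      (h1 : ∀ p, pdt (a 1) p = 2 * u p * pdx (a 1) p + c) (k : ℕ) :
      ∀ p, pdt (a (k + 2)) p = 2 * u p * pdx (a (k + 2)) p := by
    induction k with
    | zero => exact transport_of_mul_eq_pdx hu hv heqv hvx (hs 0) (hs 1) h1 (hrec_mul a hrec 0)
    | succ k ih =>
      exact transport_of_mul_eq_pdx hu hv heqv hvx (hs (k + 1)) (hs (k + 2)) (c := 0)
        (by simpa using ih) (hrec_mul a hrec (k + 1))
  set A : ℕ → ℝ × ℝ → ℝ := fun i q => if i % 2 = 0 then α (i / 2 + 1) q else β (i / 2 + 1) q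
    with hA
  have hA_even (k : ℕ) : A (2 * k) = α (k + 1) := by
    funext q
    simp [hA]
  have hA_odd (k : ℕ) : A (2 * k + 1) = β (k + 1) := by
    funext q
    simp [hA, show (2 * k + 1) / 2 = k by omega, show (2 * k + 1) % 2 = 1 by omega]
  have hA_diff (i : ℕ) : Differentiable ℝ (A i) := by
    obtain ⟨k, rfl | rfl⟩ := i.even_or_odd'
    · rw [hA_even]; exact (hα_smooth k).differentiable (by simp)
    · rw [hA_odd]; exact (hβ_smooth k).differentiable (by simp)
  have hA_pdx (i : ℕ) (p : ℝ × ℝ) : pdx (A i) p = pdx v p * A (i + 2) p := by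
    obtain ⟨k, rfl | rfl⟩ := i.even_or_odd'
    · rw [hA_even, show 2 * k + 2 = 2 * (k + 1) by ring, hA_even]
      exact hrec_mul α hαrec k p
    · rw [hA_odd, show 2 * k + 1 + 2 = 2 * (k + 1) + 1 by ring, hA_odd]
      exact hrec_mul β hβrec k p
  have hA_pdt (i : ℕ) (p : ℝ × ℝ) :
      pdt (A i) p = 2 * u p * pdx (A i) p + if i = 1 then -2 else 0 := by
    obtain ⟨k, rfl | rfl⟩ := i.even_or_odd'
    · rw [hA_even, if_neg (by omega)]
      cases k with
      | zero => exact hα1t p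
      | succ k => rw [add_zero]; exact htransport α hα_smooth hαrec 0 hα1t k p
    · rw [hA_odd]
      cases k with
      | zero => simpa using hβ1t p
      | succ k =>
        rw [if_neg (by omega), add_zero]
        exact htransport β hβ_smooth hβrec (-2) hβ1t k p
  have hPd : Differentiable ℝ P := hP.differentiable (by simp)
  have hQd : Differentiable ℝ Q := hQ.differentiable (by simp)
  intro p
  change pdt (fun q => pdx v q * P (fun i => A i q)) p
    = pdx (fun q => 2 * u q * (pdx v q * P (fun i => A i q)) + Q (fun j => A j q)) p
  have hPA : Differentiable ℝ (fun q => P (fun i => A i q)) :=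
    hPd.comp (differentiable_pi.2 fun i => hA_diff i)
  have hQA : Differentiable ℝ (fun q => Q (fun j => A j q)) :=
    hQd.comp (differentiable_pi.2 fun i => hA_diff i)
  have hPt : pdt (fun q => P (fun i => A i q)) p
      = 2 * u p * pdx (fun q => P (fun i => A i q)) p
        - 2 * pD P ⟨1, by omega⟩ (fun i => A i p) := by
    rw [pdt_comp_pi hPd (F := fun i : Fin (2 * n) => A i) (fun i => hA_diff i),
      pdx_comp_pi hPd (F := fun i : Fin (2 * n) => A i) (fun i => hA_diff i)]
    simp only [hA_pdt, mul_add, Finset.sum_add_distrib, Finset.mul_sum]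
    rw [sub_eq_add_neg]
    congr 1
    · exact Finset.sum_congr rfl fun i _ => by ring
    · rw [Finset.sum_eq_single (⟨1, by omega⟩ : Fin (2 * n))]
      · simp
        ring
      · intro i _ hi
        rw [if_neg fun h => hi (Fin.ext h), mul_zero]
      · simp
  have hQx : pdx (fun q => Q (fun j => A j q)) p
      = -2 * pdx v p * pD P ⟨1, by omega⟩ (fun i => A i p) := by
    rw [pdx_comp_pi hQd (F := fun j : Fin (2 * (n - 1)) => A j) (fun i => hA_diff i),
      sum_fin_two_mul, hPQ]
    simp only [hA_pdx, Finset.mul_sum, Fin.val_castLE]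
    exact Finset.sum_congr rfl fun k _ => by ring
  rw [pdt_mul hvxd hPA,
    pdx_add (((differentiable_const 2).fun_mul hud).fun_mul (hvxd.fun_mul hPA)) hQA,
    pdx_mul ((differentiable_const 2).fun_mul hud) (hvxd.fun_mul hPA),
    pdx_mul (differentiable_const 2) hud, pdx_const, pdx_mul hvxd hPA, hQx, hPt, hvxt]
  ring
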